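/- For integers n ≠ m and real ν with m + n + ν > −1/2, the integral ∫_0^∞ j_{ν+2n}(y)·j_{ν+2m}(y) dy = 0, where j_μ denotes the spherical Bessel function of order μ. -/

import Mathlib

open MeasureTheory

/-- Bessel function of the first kind of real order (for positive argument),
defined via its power series using the real power function. -/
noncomputable def besselJ (ν : ℝ) (x : ℝ) : ℝ :=
  ∑' k : ℕ, ((-1) ^ k / ((Nat.factorial k : ℝ) * Real.Gamma ((k : ℝ) + ν + 1))) *
    (x / 2) ^ (2 * (k : ℝ) + ν)

/-- Spherical Bessel function of real order μ for positive argument. -/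
noncomputable def sphjR (μ : ℝ) (y : ℝ) : ℝ :=
  Real.sqrt (Real.pi / (2 * y)) * besselJ (μ + 1 / 2) y

open Filter Topology

lemma Real.inv_Gamma_eq_mul_inv_Gamma_add_one (s : ℝ) :
    (Real.Gamma s)⁻¹ = s * (Real.Gamma (s + 1))⁻¹ := by
  rcases eq_or_ne s 0 with rfl | h
  · simp [Real.Gamma_zero]
  · rw [Real.Gamma_add_one h, mul_inv, mul_inv_cancel_left₀ h]

/-- The coefficients of the entire function `t ↦ t ^ (-a / 2) * J_a (2 * √t)`. -/
noncomputable def besselCoeff (a : ℝ) (k : ℕ) : ℝ :=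
  (-1) ^ k / ((Nat.factorial k : ℝ) * Real.Gamma ((k : ℝ) + a + 1))

/-- The entire function `t ↦ t ^ (-a / 2) * J_a (2 * √t)`. -/
noncomputable def besselSeries (a t : ℝ) : ℝ :=
  ∑' k : ℕ, besselCoeff a k * t ^ k

lemma besselCoeff_eq_mul_besselCoeff_add_one (a : ℝ) (k : ℕ) :
    besselCoeff a k = (k + a + 1) * besselCoeff (a + 1) k := by
  have h := Real.inv_Gamma_eq_mul_inv_Gamma_add_one (k + a + 1)
  simp only [besselCoeff, div_eq_mul_inv, mul_inv]
  rw [h, ← add_assoc (k : ℝ) a 1]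
  ring

lemma succ_mul_besselCoeff_succ (a : ℝ) (k : ℕ) :
    (k + 1) * besselCoeff a (k + 1) = -besselCoeff (a + 1) k := by
  have h : ((k + 1 : ℕ) : ℝ) + a + 1 = k + (a + 1) + 1 := by push_cast; ring
  have hk : (k : ℝ) + 1 ≠ 0 := by positivity
  simp only [besselCoeff, div_eq_mul_inv, mul_inv, Nat.factorial_succ, h]
  push_cast
  rw [mul_inv, pow_succ]
  field_simp

lemma summable_besselCoeff_mul_pow (a t : ℝ) :
    Summable fun k : ℕ => besselCoeff a k * t ^ k := by
  refine summable_of_ratio_norm_eventually_le (r := 1 / 2) (by norm_num) ?_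
  filter_upwards [eventually_ge_atTop ⌈2 * |t| + |a|⌉₊] with k hk
  have hk : 2 * |t| + |a| ≤ k := Nat.ceil_le.mp hk
  have ha := neg_abs_le a
  have h : besselCoeff a k = -((k + a + 1) * (k + 1) * besselCoeff a (k + 1)) := by
    rw [besselCoeff_eq_mul_besselCoeff_add_one, mul_assoc, succ_mul_besselCoeff_succ]
    ring
  have h₁ : 1 ≤ k + a + 1 := by linarith [abs_nonneg t]
  have h₂ : 2 * |t| ≤ k + 1 := by linarith [abs_nonneg a]
  have h₃ : 2 * |t| ≤ (k + a + 1) * (k + 1) := by nlinarith [abs_nonneg t]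
  rw [h]
  simp only [Real.norm_eq_abs, abs_mul, abs_neg, pow_succ, abs_pow]
  rw [abs_of_nonneg (by linarith : 0 ≤ (k : ℝ) + a + 1),
    abs_of_nonneg (by positivity : 0 ≤ (k : ℝ) + 1)]
  have := mul_le_mul_of_nonneg_right h₃
    (by positivity : 0 ≤ |besselCoeff a (k + 1)| * |t| ^ k)
  linarith

lemma hasDerivAt_besselSeries (a t : ℝ) :
    HasDerivAt (besselSeries a) (-besselSeries (a + 1) t) t := by
  set R := |t| + 1
  have hR : 0 < R := by positivity
  have hsum : Summable fun k : ℕ => |besselCoeff a k * (k * R ^ (k - 1))| := by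
    rw [← summable_nat_add_iff 1]
    refine (summable_besselCoeff_mul_pow (a + 1) R).abs.congr fun k => ?_
    rw [← abs_neg, ← neg_mul, ← succ_mul_besselCoeff_succ]
    push_cast
    congr 1
    ring
  have h := hasDerivAt_tsum_of_isPreconnected (𝕜 := ℝ)
    (g := fun k t => besselCoeff a k * t ^ k)
    (g' := fun k t => besselCoeff a k * (k * t ^ (k - 1)))
    hsum Metric.isOpen_ball (convex_ball (0 : ℝ) R).isPreconnected
    (fun k y _ => (hasDerivAt_pow k y).const_mul _)
    (fun k y hy => by
      have hy : |y| ≤ R := by simpa using (Metric.mem_ball.mp hy).le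
      simp only [Real.norm_eq_abs, abs_mul, abs_pow, abs_of_pos hR]
      gcongr)
    (y₀ := t) (y := t) (by simp [R]) (summable_besselCoeff_mul_pow a t) (by simp [R])
  refine h.congr_deriv ?_
  rw [tsum_eq_zero_add', besselSeries, ← tsum_neg]
  · simp only [Nat.cast_zero, zero_mul, mul_zero, zero_add, ← neg_mul,
      ← succ_mul_besselCoeff_succ]
    refine tsum_congr fun k => ?_
    push_cast
    ring
  · refine (summable_besselCoeff_mul_pow (a + 1) t).neg.congr fun k => ?_
    rw [← neg_mul, ← succ_mul_besselCoeff_succ]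
    push_cast
    ring

lemma continuous_besselSeries (a : ℝ) : Continuous (besselSeries a) :=
  continuous_iff_continuousAt.mpr fun t => (hasDerivAt_besselSeries a t).continuousAt

lemma besselSeries_eq (a t : ℝ) :
    besselSeries a t = (a + 1) * besselSeries (a + 1) t - t * besselSeries (a + 2) t := by
  have hs := summable_besselCoeff_mul_pow
  have h : Summable fun k : ℕ => k * besselCoeff (a + 1) k * t ^ k := by
    refine ((hs a t).sub ((hs (a + 1) t).mul_left (a + 1))).congr fun k => ?_
    rw [besselCoeff_eq_mul_besselCoeff_add_one a k]
    ring
  have h' : ∑' k : ℕ, k * besselCoeff (a + 1) k * t ^ k = -(t * besselSeries (a + 2) t) := by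
    rw [h.tsum_eq_zero_add, besselSeries, ← tsum_mul_left, ← tsum_neg]
    simp only [Nat.cast_zero, zero_mul, zero_add]
    refine tsum_congr fun k => ?_
    push_cast
    rw [succ_mul_besselCoeff_succ, show a + 1 + 1 = a + 2 by ring]
    ring
  rw [sub_eq_add_neg, ← h']
  simp only [besselSeries]
  rw [← tsum_mul_left, ← ((hs (a + 1) t).mul_left (a + 1)).tsum_add h]
  refine tsum_congr fun k => ?_
  rw [besselCoeff_eq_mul_besselCoeff_add_one a k]
  ring

lemma besselJ_eq_rpow_mul_besselSeries (a : ℝ) {x : ℝ} (hx : 0 < x) :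
    besselJ a x = (x / 2) ^ a * besselSeries a ((x / 2) ^ 2) := by
  have hx2 : 0 < x / 2 := by positivity
  rw [besselJ, besselSeries, ← tsum_mul_left]
  refine tsum_congr fun k => ?_
  rw [Real.rpow_add hx2, ← pow_mul, besselCoeff,
    show (2 * (k : ℝ)) = ((2 * k : ℕ) : ℝ) by push_cast; ring, Real.rpow_natCast]
  ring

lemma besselJ_add_two (a : ℝ) {x : ℝ} (hx : 0 < x) :
    besselJ (a + 2) x = 2 * (a + 1) / x * besselJ (a + 1) x - besselJ a x := by
  have hx2 : 0 < x / 2 := by positivity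
  simp only [besselJ_eq_rpow_mul_besselSeries _ hx]
  rw [besselSeries_eq a, Real.rpow_add hx2, Real.rpow_add hx2, Real.rpow_one, Real.rpow_two]
  field_simp
  ring

lemma hasDerivAt_besselJ (a : ℝ) {x : ℝ} (hx : 0 < x) :
    HasDerivAt (besselJ a) (a / x * besselJ a x - besselJ (a + 1) x) x := by
  have hx2 : 0 < x / 2 := by positivity
  have h₁ : HasDerivAt (fun x : ℝ => x / 2) (1 / 2) x := (hasDerivAt_id x).div_const 2
  have h₂ := h₁.rpow_const (p := a) (Or.inl hx2.ne')
  have h₃ := (hasDerivAt_besselSeries a ((x / 2) ^ 2)).comp x (h₁.pow 2)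
  have h₄ : besselJ a =ᶠ[𝓝 x] fun x => (x / 2) ^ a * besselSeries a ((x / 2) ^ 2) := by
    filter_upwards [lt_mem_nhds hx] with y hy using besselJ_eq_rpow_mul_besselSeries a hy
  refine ((h₂.mul h₃).congr_of_eventuallyEq h₄).congr_deriv ?_
  simp only [besselJ_eq_rpow_mul_besselSeries _ hx, Function.comp]
  rw [Real.rpow_sub_one hx2.ne', Real.rpow_add hx2, Real.rpow_one]
  field_simp
  simp
  ring_nf

lemma hasDerivAt_besselJ_add_one (a : ℝ) {x : ℝ} (hx : 0 < x) :
    HasDerivAt (besselJ (a + 1)) (besselJ a x - (a + 1) / x * besselJ (a + 1) x) x := by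
  refine (hasDerivAt_besselJ (a + 1) hx).congr_deriv ?_
  rw [add_assoc, one_add_one_eq_two, besselJ_add_two a hx]
  ring

/-- An energy estimate: the modified energy
`x * (J_a ^ 2 + J_{a+1} ^ 2) - (1 + 2 * a) * J_a * J_{a+1}` has derivative `O(x⁻²)` times itself. -/
lemma exists_mul_besselJ_sq_le (a : ℝ) :
    ∃ K X : ℝ, 0 < X ∧ ∀ x, X ≤ x → x * besselJ a x ^ 2 ≤ K := by
  set C := |1 + 2 * a|
  set X := C + 1
  have hC : 0 ≤ C := abs_nonneg _
  have hX : 0 < X := by positivity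
  let E : ℝ → ℝ := fun x => x * (besselJ a x ^ 2 + besselJ (a + 1) x ^ 2)
    - (1 + 2 * a) * (besselJ a x * besselJ (a + 1) x)
  have hmul : ∀ x, |(1 + 2 * a) * (besselJ a x * besselJ (a + 1) x)| ≤
      C * ((besselJ a x ^ 2 + besselJ (a + 1) x ^ 2) / 2) := fun x => by
    rw [abs_mul]
    refine mul_le_mul_of_nonneg_left ?_ hC
    rw [abs_le]
    constructor <;> nlinarith [sq_nonneg (besselJ a x + besselJ (a + 1) x),
      sq_nonneg (besselJ a x - besselJ (a + 1) x)]
  have hE : ∀ x, X ≤ x → x * (besselJ a x ^ 2 + besselJ (a + 1) x ^ 2) ≤ 2 * E x := fun x hx => by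
    have h := (abs_le.mp (hmul x)).2
    have : C * (besselJ a x ^ 2 + besselJ (a + 1) x ^ 2) ≤
        x * (besselJ a x ^ 2 + besselJ (a + 1) x ^ 2) := by
      gcongr
      linarith
    simp only [E]
    linarith
  have hE' : ∀ x, 0 < x → HasDerivAt E
      ((1 + 2 * a) * (besselJ a x * besselJ (a + 1) x) / x) x := fun x hx => by
    have hu := hasDerivAt_besselJ a hx
    have hp := hasDerivAt_besselJ_add_one a hx
    refine (((hasDerivAt_id x).mul ((hu.pow 2).add (hp.pow 2))).sub
      ((hu.mul hp).const_mul (1 + 2 * a))).congr_deriv ?_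
    simp
    field_simp
    ring
  have hF' : ∀ x, 0 < x → HasDerivAt (fun x => E x * Real.exp (C / x))
      (((1 + 2 * a) * (besselJ a x * besselJ (a + 1) x) / x - C * E x / x ^ 2)
        * Real.exp (C / x)) x := fun x hx => by
    have hinv := ((hasDerivAt_inv hx.ne').const_mul C).exp
    simp only [← div_eq_mul_inv] at hinv
    refine ((hE' x hx).mul hinv).congr_deriv ?_
    field_simp
    ring
  have hanti : AntitoneOn (fun x => E x * Real.exp (C / x)) (Set.Ici X) := by
    refine antitoneOn_of_deriv_nonpos (convex_Ici X)
      (fun x hx => (hF' x (hX.trans_le hx)).continuousAt.continuousWithinAt)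
      (fun x hx => (hF' x (hX.trans_le
        (interior_subset hx))).differentiableAt.differentiableWithinAt) fun x hx => ?_
    have hx : X ≤ x := interior_subset hx
    have hx0 := hX.trans_le hx
    rw [(hF' x hx0).deriv]
    refine mul_nonpos_of_nonpos_of_nonneg ?_ (Real.exp_nonneg _)
    have h₁ := (abs_le.mp (hmul x)).2
    have h₂ := mul_le_mul_of_nonneg_left (hE x hx) hC
    have : (1 + 2 * a) * (besselJ a x * besselJ (a + 1) x) * x ≤ C * E x := by
      nlinarith [mul_le_mul_of_nonneg_right h₁ hx0.le]
    rw [sub_nonpos, div_le_div_iff₀ hx0 (by positivity)]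
    nlinarith [mul_le_mul_of_nonneg_right this hx0.le]
  refine ⟨2 * (E X * Real.exp (C / X)), X, hX, fun x hx => ?_⟩
  have hx0 := hX.trans_le hx
  have h₁ := hE x hx
  have h₂ : 0 ≤ x * besselJ (a + 1) x ^ 2 := by positivity
  have h₃ : 0 ≤ x * besselJ a x ^ 2 := by positivity
  have h₄ : E x * 1 ≤ E x * Real.exp (C / x) :=
    mul_le_mul_of_nonneg_left (Real.one_le_exp (by positivity)) (by linarith)
  have h₅ := hanti (Set.mem_Ici.mpr le_rfl) (Set.mem_Ici.mpr hx) hx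
  simp only at h₅
  linarith

lemma tendsto_besselJ_atTop (a : ℝ) : Tendsto (besselJ a) atTop (𝓝 0) := by
  obtain ⟨K, X, hX, h⟩ := exists_mul_besselJ_sq_le a
  have hsq : Tendsto (fun x => besselJ a x ^ 2) atTop (𝓝 0) := by
    refine squeeze_zero' (g := fun x => K / x) (Eventually.of_forall fun x => sq_nonneg _) ?_
      (tendsto_const_nhds.div_atTop tendsto_id)
    filter_upwards [eventually_ge_atTop X] with x hx
    rw [le_div_iff₀ (hX.trans_le hx), mul_comm]
    exact h x hx
  refine (tendsto_zero_iff_abs_tendsto_zero _).mpr ?_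
  simpa [Function.comp_def, Real.sqrt_sq_eq_abs] using hsq.sqrt

lemma tendsto_mul_besselJ_cross_atTop (a : ℝ) (k : ℕ) :
    Tendsto (fun x => x * (besselJ (a + 1) x * besselJ (a + 2 * k) x
      - besselJ a x * besselJ (a + 2 * k + 1) x)) atTop (𝓝 0) := by
  induction k with
  | zero =>
    refine tendsto_const_nhds.congr fun x => ?_
    simp [mul_comm]
  | succ k ih =>
    set b := a + 2 * (k : ℝ)
    have hb : a + 2 * ((k + 1 : ℕ) : ℝ) = b + 2 := by simp only [b]; push_cast; ring
    have hJ := tendsto_besselJ_atTop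
    have hlim : Tendsto (fun x => -(x * (besselJ (a + 1) x * besselJ b x
        - besselJ a x * besselJ (b + 1) x))
        + 2 * (b + 1) * (besselJ (a + 1) x * besselJ (b + 1) x)
        - 2 * (b + 2) * (besselJ a x * besselJ (b + 2) x)) atTop (𝓝 0) := by
      simpa using (ih.neg.add (((hJ (a + 1)).mul (hJ (b + 1))).const_mul (2 * (b + 1)))).sub
        (((hJ a).mul (hJ (b + 2))).const_mul (2 * (b + 2)))
    refine hlim.congr' ?_
    filter_upwards [eventually_gt_atTop 0] with x hx
    have h₃ := besselJ_add_two (b + 1) hx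
    rw [show b + 1 + 2 = b + 2 + 1 by ring, show b + 1 + 1 = b + 2 by ring] at h₃
    rw [hb, h₃, besselJ_add_two b hx]
    field_simp
    ring

/-- `x` times the Wronskian of `J_a` and `J_b`, in terms of the entire functions. -/
noncomputable def besselWronskian (a b x : ℝ) : ℝ :=
  (x / 2) ^ (a + b) * ((a - b) * (besselSeries a ((x / 2) ^ 2) * besselSeries b ((x / 2) ^ 2))
    - x ^ 2 / 2 * (besselSeries (a + 1) ((x / 2) ^ 2) * besselSeries b ((x / 2) ^ 2)
      - besselSeries a ((x / 2) ^ 2) * besselSeries (b + 1) ((x / 2) ^ 2)))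

lemma besselWronskian_eq (a b : ℝ) {x : ℝ} (hx : 0 < x) :
    besselWronskian a b x = (a - b) * (besselJ a x * besselJ b x)
      - x * (besselJ (a + 1) x * besselJ b x - besselJ a x * besselJ (b + 1) x) := by
  have hx2 : 0 < x / 2 := by positivity
  simp only [besselJ_eq_rpow_mul_besselSeries _ hx, besselWronskian]
  rw [Real.rpow_add hx2, Real.rpow_add hx2, Real.rpow_add hx2, Real.rpow_one]
  ring

lemma hasDerivAt_besselWronskian (a b : ℝ) {x : ℝ} (hx : 0 < x) :
    HasDerivAt (besselWronskian a b)
      ((a ^ 2 - b ^ 2) / x * (besselJ a x * besselJ b x)) x := by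
  have hu := hasDerivAt_besselJ a hx
  have hp := hasDerivAt_besselJ_add_one a hx
  have hv := hasDerivAt_besselJ b hx
  have hq := hasDerivAt_besselJ_add_one b hx
  have h : besselWronskian a b =ᶠ[𝓝 x] fun x => (a - b) * (besselJ a x * besselJ b x)
      - x * (besselJ (a + 1) x * besselJ b x - besselJ a x * besselJ (b + 1) x) := by
    filter_upwards [lt_mem_nhds hx] with y hy using besselWronskian_eq a b hy
  refine ((((hu.mul hv).const_mul (a - b)).sub ((hasDerivAt_id x).mul
    ((hp.mul hv).sub (hu.mul hq)))).congr_of_eventuallyEq h).congr_deriv ?_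
  simp
  field_simp
  ring

lemma continuous_besselWronskian {a b : ℝ} (hab : 0 < a + b) :
    Continuous (besselWronskian a b) := by
  have h : ∀ c, Continuous fun x : ℝ => besselSeries c ((x / 2) ^ 2) := fun c =>
    (continuous_besselSeries c).comp (by fun_prop)
  have hpow : Continuous fun x : ℝ => (x / 2) ^ (a + b) :=
    (continuous_id.div_const 2).rpow_const fun _ => Or.inr hab.le
  have ha := h a
  have hb := h b
  have ha' := h (a + 1)
  have hb' := h (b + 1)
  unfold besselWronskian
  fun_prop

lemma tendsto_besselWronskian_atTop (a : ℝ) (k : ℕ) :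
    Tendsto (besselWronskian a (a + 2 * k)) atTop (𝓝 0) := by
  have h := ((((tendsto_besselJ_atTop a).mul (tendsto_besselJ_atTop (a + 2 * k))).const_mul
    (a - (a + 2 * k))).sub (tendsto_mul_besselJ_cross_atTop a k))
  simp only [mul_zero, sub_zero] at h
  refine h.congr' ?_
  filter_upwards [eventually_gt_atTop 0] with x hx
  rw [besselWronskian_eq a _ hx]

lemma integral_besselJ_mul_besselJ_div {a : ℝ} {k : ℕ} (hk : k ≠ 0) (ha : 0 < a + k) :
    ∫ x in Set.Ioi (0 : ℝ), besselJ a x * besselJ (a + 2 * k) x / x = 0 := by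
  by_cases hint : IntegrableOn (fun x => besselJ a x * besselJ (a + 2 * k) x / x) (Set.Ioi 0)
  swap
  · exact integral_undef hint
  have hs : 0 < a + (a + 2 * k) := by linarith
  have hne : a ^ 2 - (a + 2 * k) ^ 2 ≠ 0 := by
    have : (0 : ℝ) < k := by positivity
    have := mul_pos this ha
    nlinarith
  have h := integral_Ioi_of_hasDerivAt_of_tendsto
    (f := besselWronskian a (a + 2 * k)) (a := 0)
    (f' := fun x => (a ^ 2 - (a + 2 * k) ^ 2) * (besselJ a x * besselJ (a + 2 * k) x / x))
    (continuous_besselWronskian hs).continuousWithinAt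
    (fun x hx => (hasDerivAt_besselWronskian a _ hx).congr_deriv (by ring))
    (hint.const_mul _) (tendsto_besselWronskian_atTop a k)
  rw [integral_const_mul, besselWronskian, zero_div, Real.zero_rpow hs.ne', zero_mul,
    sub_zero] at h
  exact (mul_eq_zero.mp h).resolve_left hne

lemma sphjR_mul_sphjR (μ ρ : ℝ) {y : ℝ} (hy : 0 < y) :
    sphjR μ y * sphjR ρ y =
      Real.pi / 2 * (besselJ (μ + 1 / 2) y * besselJ (ρ + 1 / 2) y / y) := by
  have h : √(Real.pi / (2 * y)) * √(Real.pi / (2 * y)) = Real.pi / (2 * y) :=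
    Real.mul_self_sqrt (by positivity)
  rw [sphjR, sphjR, mul_mul_mul_comm, h]
  field_simp

lemma integral_sphjR_mul_sphjR {μ : ℝ} {k : ℕ} (hk : k ≠ 0) (hμ : -1 / 2 < μ + k) :
    ∫ y in Set.Ioi (0 : ℝ), sphjR μ y * sphjR (μ + 2 * k) y = 0 := by
  rw [setIntegral_congr_fun measurableSet_Ioi fun y hy => sphjR_mul_sphjR μ (μ + 2 * k) hy,
    integral_const_mul, show μ + 2 * k + 1 / 2 = μ + 1 / 2 + 2 * k by ring,
    integral_besselJ_mul_besselJ_div hk (by linarith), mul_zero]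

theorem sphj_orthogonality (n m : ℤ) (hnm : n ≠ m) (ν : ℝ)
    (h : (m : ℝ) + (n : ℝ) + ν > -1 / 2) :
    ∫ y in Set.Ioi (0:ℝ), sphjR (ν + 2 * n) y * sphjR (ν + 2 * m) y = 0 := by
  wlog hlt : n < m generalizing n m
  · simpa only [mul_comm] using this m n hnm.symm (by linarith) (by omega)
  obtain ⟨k, hk⟩ := Int.eq_ofNat_of_zero_le (sub_nonneg.mpr hlt.le)
  obtain rfl : m = n + k := by omega
  push_cast at h ⊢
  rw [mul_add, ← add_assoc]
  exact integral_sphjR_mul_sphjR (by omega) (by linarith)
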